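/- ∑_{k=0}^∞ (7/2)_k^3 / [(k!)^2 · (k+3)!] · (6k+7)/4^k = 2048/(15π). -/

import Mathlib

/-- The Pochhammer symbol `(x)ₖ = x (x+1) ⋯ (x+k-1)`, with `(x)₀ = 1`. -/
noncomputable def poch (x : ℝ) (k : ℕ) : ℝ :=
  ∏ i ∈ Finset.range k, (x + i)

open Filter Topology

lemma poch_succ (x : ℝ) (n : ℕ) : poch x (n + 1) = poch x n * (x + n) :=
  Finset.prod_range_succ _ _

lemma poch_pos {x : ℝ} (hx : 0 < x) (n : ℕ) : 0 < poch x n :=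
  Finset.prod_pos fun _ _ => by positivity

lemma mul_poch_add_one (x : ℝ) (n : ℕ) : x * poch (x + 1) n = poch x n * (x + n) := by
  induction n with
  | zero => simp [poch]
  | succ n ih =>
    rw [poch_succ, poch_succ, ← mul_assoc, ih]
    push_cast
    ring

lemma poch_half_le_factorial (n : ℕ) : poch (1 / 2) n ≤ (n.factorial : ℝ) := by
  induction n with
  | zero => simp [poch]
  | succ n ih =>
    rw [poch_succ, Nat.factorial_succ]
    push_cast
    nlinarith [Nat.cast_nonneg (α := ℝ) n, (poch_pos (x := 1 / 2) (by norm_num) n).le,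
      Nat.cast_nonneg (α := ℝ) n.factorial]

/-- The first component of a Wilf–Zeilberger pair whose sum over `n` is `4 / π` for every `k`. -/
noncomputable def ramanujanWZ (n k : ℕ) : ℝ :=
  poch (1 / 2) n ^ 3 * poch (1 / 2) k ^ 2 / (n.factorial * ((n + k).factorial : ℝ) ^ 2) *
    ((6 * n + 4 * k + 1) / 4 ^ n)

/-- The companion of `ramanujanWZ`. -/
noncomputable def ramanujanWZCompanion (n k : ℕ) : ℝ :=
  poch (1 / 2) n ^ 3 * poch (1 / 2) k ^ 2 / (n.factorial * ((n + k).factorial : ℝ) ^ 2) *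
    (8 * n / 4 ^ n)

lemma ramanujanWZ_nonneg (n k : ℕ) : 0 ≤ ramanujanWZ n k := by
  have h1 := poch_pos (x := 1 / 2) (by norm_num) n
  have h2 := poch_pos (x := 1 / 2) (by norm_num) k
  unfold ramanujanWZ
  positivity

lemma ramanujanWZ_sub (n k : ℕ) :
    ramanujanWZ n (k + 1) - ramanujanWZ n k =
      ramanujanWZCompanion (n + 1) k - ramanujanWZCompanion n k := by
  have h1 : (n.factorial : ℝ) ≠ 0 := by positivity
  have h2 : ((n + k).factorial : ℝ) ≠ 0 := by positivity
  have h3 : (n + k + 1 : ℝ) ≠ 0 := by positivity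
  have h4 : (n + 1 : ℝ) ≠ 0 := by positivity
  unfold ramanujanWZ ramanujanWZCompanion
  rw [show n + (k + 1) = n + k + 1 by ring, show n + 1 + k = n + k + 1 by ring,
    Nat.factorial_succ (n + k), Nat.factorial_succ n, poch_succ, poch_succ]
  push_cast
  field_simp
  ring

lemma sum_ramanujanWZ_succ (k N : ℕ) :
    ∑ n ∈ Finset.range N, ramanujanWZ n (k + 1) =
      ∑ n ∈ Finset.range N, ramanujanWZ n k + ramanujanWZCompanion N k := by
  have h := Finset.sum_range_sub (fun n => ramanujanWZCompanion n k) N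
  simp only [← ramanujanWZ_sub, Finset.sum_sub_distrib] at h
  have h0 : ramanujanWZCompanion 0 k = 0 := by simp [ramanujanWZCompanion]
  linarith

lemma poch_half_sq_mul_le (k : ℕ) : (poch (1 / 2) k / k.factorial) ^ 2 * (2 * k + 1) ≤ 1 := by
  induction k with
  | zero => simp [poch]
  | succ k ih =>
    refine le_trans ?_ ih
    have h1 : (k.factorial : ℝ) ≠ 0 := by positivity
    rw [poch_succ, Nat.factorial_succ]
    push_cast
    rw [mul_comm ((k : ℝ) + 1), mul_div_mul_comm, mul_pow, mul_assoc]
    gcongr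
    rw [div_pow, div_mul_eq_mul_div, div_le_iff₀ (by positivity)]
    nlinarith [Nat.cast_nonneg (α := ℝ) k]

lemma poch_coeff_le {n k : ℕ} {A B : ℝ} (hA : 0 ≤ A) (hB : 0 < B)
    (hn : poch (1 / 2) n ^ 3 / n.factorial ≤ A)
    (hfac : (k.factorial : ℝ) * B ≤ (n + k).factorial) :
    poch (1 / 2) n ^ 3 * poch (1 / 2) k ^ 2 / (n.factorial * ((n + k).factorial : ℝ) ^ 2) ≤
      A / B ^ 2 * (poch (1 / 2) k / k.factorial) ^ 2 := by
  have hp := poch_pos (x := 1 / 2) (by norm_num) k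
  have hk : (0 : ℝ) < k.factorial := by positivity
  calc _ = poch (1 / 2) n ^ 3 / n.factorial * (poch (1 / 2) k / (n + k).factorial) ^ 2 := by
        field_simp
    _ ≤ A * (poch (1 / 2) k / (k.factorial * B)) ^ 2 := by gcongr
    _ = _ := by field_simp

lemma poch_half_cube_div_le (n : ℕ) :
    poch (1 / 2) n ^ 3 / n.factorial ≤ (n.factorial : ℝ) ^ 2 := by
  have hp := poch_pos (x := 1 / 2) (by norm_num) n
  rw [div_le_iff₀ (by positivity)]
  calc _ ≤ (n.factorial : ℝ) ^ 3 := by gcongr; exact poch_half_le_factorial n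
    _ = _ := by ring

lemma poch_coeff_le_sq (n k : ℕ) :
    poch (1 / 2) n ^ 3 * poch (1 / 2) k ^ 2 / (n.factorial * ((n + k).factorial : ℝ) ^ 2) ≤
      (poch (1 / 2) k / k.factorial) ^ 2 := by
  have hn : (n.factorial : ℝ) ≠ 0 := by positivity
  have h := poch_coeff_le (n := n) (k := k) (A := (n.factorial : ℝ) ^ 2) (B := n.factorial)
    (by positivity) (by positivity) (poch_half_cube_div_le n)
    (by
      rw [add_comm n k]
      exact_mod_cast Nat.le_of_dvd (Nat.factorial_pos _)
        (Nat.factorial_mul_factorial_dvd_factorial_add k n))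
  rwa [div_self (by positivity), one_mul] at h

lemma poch_half_sq_mul_linear_le (n k : ℕ) :
    (poch (1 / 2) k / k.factorial) ^ 2 * (6 * n + 4 * k + 1) ≤ 6 * n + 2 := by
  have h := poch_half_sq_mul_le k
  have h0 : 0 ≤ (poch (1 / 2) k / k.factorial) ^ 2 := by positivity
  calc _ ≤ (poch (1 / 2) k / k.factorial) ^ 2 * ((2 * k + 1) * (6 * n + 2)) := by
        gcongr
        nlinarith [mul_nonneg (Nat.cast_nonneg (α := ℝ) k) (Nat.cast_nonneg (α := ℝ) n)]
    _ = (poch (1 / 2) k / k.factorial) ^ 2 * (2 * k + 1) * (6 * n + 2) := by ring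
    _ ≤ 1 * (6 * n + 2) := by gcongr
    _ = _ := one_mul _

lemma ramanujanWZ_le (n k : ℕ) : ramanujanWZ n k ≤ (6 * n + 2) * (1 / 4) ^ n := by
  calc ramanujanWZ n k
      ≤ (poch (1 / 2) k / k.factorial) ^ 2 * ((6 * n + 4 * k + 1) / 4 ^ n) := by
        unfold ramanujanWZ
        gcongr
        exact poch_coeff_le_sq n k
    _ = (poch (1 / 2) k / k.factorial) ^ 2 * (6 * n + 4 * k + 1) * (1 / 4) ^ n := by
        rw [one_div_pow]; ring
    _ ≤ _ := by gcongr; exact poch_half_sq_mul_linear_le n k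

lemma summable_linear_mul_geometric : Summable fun n : ℕ => (6 * n + 2 : ℝ) * (1 / 4) ^ n := by
  have h1 := summable_pow_mul_geometric_of_norm_lt_one (R := ℝ) 1 (r := 1 / 4) (by norm_num)
  have h0 := summable_pow_mul_geometric_of_norm_lt_one (R := ℝ) 0 (r := 1 / 4) (by norm_num)
  refine ((h1.mul_left 6).add (h0.mul_left 2)).congr fun n => ?_
  simp only [pow_one, pow_zero]
  ring

lemma summable_ramanujanWZ (k : ℕ) : Summable fun n => ramanujanWZ n k :=
  summable_linear_mul_geometric.of_nonneg_of_le (fun n => ramanujanWZ_nonneg n k)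
    fun n => ramanujanWZ_le n k

lemma tendsto_ramanujanWZCompanion (k : ℕ) :
    Tendsto (fun n => ramanujanWZCompanion n k) atTop (𝓝 0) := by
  have h := (tendsto_self_mul_const_pow_of_lt_one (r := 1 / 4)
    (by norm_num) (by norm_num)).const_mul ((poch (1 / 2) k / k.factorial) ^ 2 * 8)
  rw [mul_zero] at h
  refine squeeze_zero (fun n => ?_) (fun n => ?_) h
  · have h1 := poch_pos (x := 1 / 2) (by norm_num) n
    unfold ramanujanWZCompanion
    positivity
  · calc ramanujanWZCompanion n k
        ≤ (poch (1 / 2) k / k.factorial) ^ 2 * (8 * n / 4 ^ n) := by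
          unfold ramanujanWZCompanion
          gcongr
          exact poch_coeff_le_sq n k
      _ = _ := by rw [one_div_pow]; ring

lemma tsum_ramanujanWZ_eq_zero_index (k : ℕ) :
    ∑' n, ramanujanWZ n k = ∑' n, ramanujanWZ n 0 := by
  induction k with
  | zero => rfl
  | succ k ih =>
    rw [← ih]
    refine HasSum.tsum_eq ((hasSum_iff_tendsto_nat_of_nonneg
      (fun n => ramanujanWZ_nonneg n _) _).2 ?_)
    simp only [sum_ramanujanWZ_succ]
    simpa using (summable_ramanujanWZ k).hasSum.tendsto_sum_nat.add
      (tendsto_ramanujanWZCompanion k)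

lemma poch_half_sq_mul_wallis (k : ℕ) :
    (poch (1 / 2) k / k.factorial) ^ 2 * (2 * k + 1) * Real.Wallis.W k = 1 := by
  induction k with
  | zero => simp [poch, Real.Wallis.W]
  | succ k ih =>
    have h1 : (k.factorial : ℝ) ≠ 0 := by positivity
    have h2 : (2 * k + 1 : ℝ) ≠ 0 := by positivity
    have h3 : (2 * k + 3 : ℝ) ≠ 0 := by positivity
    rw [Real.Wallis.W_succ, poch_succ, Nat.factorial_succ]
    refine Eq.trans ?_ ih
    push_cast
    field_simp
    ring

lemma tendsto_ramanujanWZ_zero : Tendsto (ramanujanWZ 0) atTop (𝓝 (4 / Real.pi)) := by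
  have h1 := tendsto_add_mul_div_add_mul_atTop_nhds (1 : ℝ) 1 4 (d := 2) (by norm_num)
  have h2 := h1.div Real.Wallis.tendsto_W_nhds_pi_div_two (by positivity)
  rw [show (4 / 2 / (Real.pi / 2) : ℝ) = 4 / Real.pi by field_simp] at h2
  refine h2.congr fun k => ?_
  have hW := Real.Wallis.W_pos k
  have h := poch_half_sq_mul_wallis k
  have hk : (1 + 2 * k : ℝ) ≠ 0 := by positivity
  have e : ramanujanWZ 0 k = (poch (1 / 2) k / k.factorial) ^ 2 * (1 + 4 * k) := by
    simp [ramanujanWZ, poch]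
    ring
  simp only [Pi.div_apply]
  rw [e, div_div, div_eq_iff (by positivity)]
  linear_combination (-(1 + 4 * k : ℝ)) * h

lemma tendsto_ramanujanWZ_succ (n : ℕ) : Tendsto (ramanujanWZ (n + 1)) atTop (𝓝 0) := by
  have hC := (tendsto_one_div_add_atTop_nhds_zero_nat (𝕜 := ℝ)).const_mul
    (((n + 1).factorial : ℝ) ^ 2 * (6 * (n + 1 : ℕ) + 2))
  rw [mul_zero] at hC
  refine squeeze_zero (fun k => ramanujanWZ_nonneg _ _) (fun k => ?_) hC
  have h := poch_coeff_le (n := n + 1) (k := k) (B := k + 1) (by positivity) (by positivity)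
    (poch_half_cube_div_le (n + 1))
    (by
      rw [mul_comm]
      exact_mod_cast (Nat.factorial_succ k).symm.le.trans (Nat.factorial_le (by omega)))
  have h4 : (1 : ℝ) ≤ 4 ^ (n + 1) := one_le_pow₀ (by norm_num)
  have hk : ((k : ℝ) + 1) ≤ (k + 1) ^ 2 := le_self_pow₀ (by simp) (by norm_num)
  calc ramanujanWZ (n + 1) k
      ≤ ((n + 1).factorial : ℝ) ^ 2 / (k + 1) ^ 2 * (poch (1 / 2) k / k.factorial) ^ 2 *
          (6 * (n + 1 : ℕ) + 4 * k + 1) := by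
        unfold ramanujanWZ
        gcongr
        exact div_le_self (by positivity) h4
    _ = ((n + 1).factorial : ℝ) ^ 2 / (k + 1) ^ 2 * ((poch (1 / 2) k / k.factorial) ^ 2 *
          (6 * (n + 1 : ℕ) + 4 * k + 1)) := by ring
    _ ≤ ((n + 1).factorial : ℝ) ^ 2 / (k + 1) * (6 * (n + 1 : ℕ) + 2) := by
        gcongr
        exact poch_half_sq_mul_linear_le (n + 1) k
    _ = _ := by ring

lemma hasSum_ramanujanWZ_zero_index : HasSum (fun n => ramanujanWZ n 0) (4 / Real.pi) := by
  have hlim : ∀ n, Tendsto (ramanujanWZ n) atTop (𝓝 (if n = 0 then 4 / Real.pi else 0)) := by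
    rintro (_ | n)
    · simpa using tendsto_ramanujanWZ_zero
    · simpa using tendsto_ramanujanWZ_succ n
  have h := tendsto_tsum_of_dominated_convergence (𝓕 := atTop)
    (f := fun k n => ramanujanWZ n k) summable_linear_mul_geometric hlim
    (Eventually.of_forall fun k n => by
      rw [Real.norm_of_nonneg (ramanujanWZ_nonneg n k)]
      exact ramanujanWZ_le n k)
  simp only [tsum_ramanujanWZ_eq_zero_index, tsum_ite_eq] at h
  rw [← tendsto_nhds_unique tendsto_const_nhds h]
  exact (summable_ramanujanWZ 0).hasSum

/-- The hypergeometric term `(r + 1/2)ₙ³ / (n!² (n + r)! 4ⁿ)`. -/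
noncomputable def shiftedTerm (r n : ℕ) : ℝ :=
  poch (r + 1 / 2) n ^ 3 / ((n.factorial : ℝ) ^ 2 * ((n + r).factorial : ℝ)) / 4 ^ n

lemma shiftedTerm_pos (r n : ℕ) : 0 < shiftedTerm r n := by
  have h := poch_pos (x := r + 1 / 2) (by positivity) n
  unfold shiftedTerm
  positivity

lemma shiftedTerm_succ_right (r n : ℕ) :
    shiftedTerm r (n + 1) =
      shiftedTerm r n * ((n + r + 1 / 2) ^ 3 / (4 * (n + 1) ^ 2 * (n + r + 1))) := by
  unfold shiftedTerm
  rw [show n + 1 + r = n + r + 1 by ring, Nat.factorial_succ (n + r), Nat.factorial_succ n,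
    poch_succ]
  push_cast
  field_simp
  ring

lemma shiftedTerm_succ_left (r n : ℕ) :
    shiftedTerm (r + 1) n =
      shiftedTerm r n * ((n + r + 1 / 2) ^ 3 / ((r + 1 / 2) ^ 3 * (n + r + 1))) := by
  have h : poch ((r + 1 : ℕ) + 1 / 2) n =
      poch (r + 1 / 2) n * (n + r + 1 / 2) / (r + 1 / 2) := by
    rw [eq_div_iff (by positivity), mul_comm, Nat.cast_succ,
      show (r + 1 + 1 / 2 : ℝ) = r + 1 / 2 + 1 by ring, mul_poch_add_one]
    ring
  unfold shiftedTerm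
  rw [show n + (r + 1) = n + r + 1 by ring, Nat.factorial_succ (n + r), h]
  push_cast
  field_simp

/-- The Gosper certificate relating the series for `r + 1` to the series for `r`. -/
noncomputable def shiftedCertificate (r n : ℕ) : ℝ :=
  shiftedTerm r n * (n ^ 2 * (n + 3 * (r + 1 / 2)))

lemma shiftedTerm_recurrence (r n : ℕ) :
    shiftedTerm (r + 1) n * (6 * n + 2 * (r + 1 : ℕ) + 1) -
        8 / (2 * r + 1) * (shiftedTerm r n * (6 * n + 2 * r + 1)) =
      -8 / (r + 1 / 2) ^ 3 * (shiftedCertificate r (n + 1) - shiftedCertificate r n) := by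
  unfold shiftedCertificate
  rw [shiftedTerm_succ_left, shiftedTerm_succ_right]
  push_cast
  field_simp
  ring

lemma tendsto_shiftedCertificate (r : ℕ) :
    Tendsto (shiftedCertificate r) atTop (𝓝 0) := by
  have hpos : ∀ n : ℕ, 0 < n → 0 < shiftedCertificate r n := fun n hn => by
    have h := shiftedTerm_pos r n
    unfold shiftedCertificate
    positivity
  have key (a b : ℝ) : Tendsto (fun n : ℕ => (a + 1 * n) / (b + 1 * n)) atTop (𝓝 1) := by
    simpa using tendsto_add_mul_div_add_mul_atTop_nhds a b 1 (d := 1) one_ne_zero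
  have hlim := ((((key (r + 1 / 2) 0).pow 2).mul (key (r + 1 / 2) (r + 1))).mul
    (key (1 + 3 * (r + 1 / 2)) (3 * (r + 1 / 2)))).div_const 4
  norm_num only at hlim
  refine (summable_of_ratio_test_tendsto_lt_one (l := 1 / 4) (by norm_num)
    ((eventually_gt_atTop 0).mono fun n hn => (hpos n hn).ne') ?_).tendsto_atTop_zero
  refine hlim.congr' ((eventually_gt_atTop 0).mono fun n hn => ?_)
  beta_reduce
  rw [Real.norm_of_nonneg (hpos n hn).le, Real.norm_of_nonneg (hpos _ n.succ_pos).le]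
  unfold shiftedCertificate
  rw [shiftedTerm_succ_right]
  have h := shiftedTerm_pos r n
  have hn' : (0 : ℝ) < n := by exact_mod_cast hn
  push_cast
  field_simp
  ring

lemma HasSum.shiftedTerm_succ {r : ℕ} {S : ℝ}
    (hS : HasSum (fun n : ℕ => shiftedTerm r n * (6 * n + 2 * r + 1)) S) :
    HasSum (fun n : ℕ => shiftedTerm (r + 1) n * (6 * n + 2 * (r + 1 : ℕ) + 1))
      (8 / (2 * r + 1) * S) := by
  refine (hasSum_iff_tendsto_nat_of_nonneg (fun n => ?_) _).2 ?_
  · have h := shiftedTerm_pos (r + 1) n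
    positivity
  have hsum (N : ℕ) :
      ∑ n ∈ Finset.range N, shiftedTerm (r + 1) n * (6 * n + 2 * (r + 1 : ℕ) + 1) =
        8 / (2 * r + 1) * ∑ n ∈ Finset.range N, shiftedTerm r n * (6 * n + 2 * r + 1) +
          -8 / (r + 1 / 2) ^ 3 * shiftedCertificate r N := by
    have h0 : shiftedCertificate r 0 = 0 := by simp [shiftedCertificate]
    have h := Finset.sum_range_sub (shiftedCertificate r) N
    rw [h0, sub_zero] at h
    rw [← h, Finset.mul_sum, Finset.mul_sum, ← Finset.sum_add_distrib]
    refine Finset.sum_congr rfl fun n _ => ?_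
    linarith [shiftedTerm_recurrence r n]
  simp only [hsum]
  simpa using (hS.tendsto_sum_nat.const_mul (8 / (2 * r + 1 : ℝ))).add
    ((tendsto_shiftedCertificate r).const_mul (-8 / (r + 1 / 2 : ℝ) ^ 3))

theorem example_thm2_p1q1r3 :
    ∑' k : ℕ, (poch (7/2) k ^ 3) / ((k.factorial : ℝ) ^ 2 * ((k + 3).factorial : ℝ)) * ((6*(k : ℝ) + 7) / (4 : ℝ) ^ k) = 2048 / (15 * Real.pi) := by
  have h0 : HasSum (fun n : ℕ => shiftedTerm 0 n * (6 * n + 2 * (0 : ℕ) + 1)) (4 / Real.pi) := by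
    convert hasSum_ramanujanWZ_zero_index using 2 with n
    simp [shiftedTerm, ramanujanWZ, poch]
    field_simp
  have h3 := h0.shiftedTerm_succ.shiftedTerm_succ.shiftedTerm_succ
  convert h3.tsum_eq using 1
  · refine tsum_congr fun k => ?_
    unfold shiftedTerm
    norm_num only [Nat.cast_ofNat]
    ring
  · push_cast
    field_simp
    norm_num
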